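/- Let (L, w)/(K, v) be a finite separable extension of henselian valued fields and α ∈ 𝒪_w with Tr_{L/K}(α) ≠ 0. Then for every λ ∈ K there is an expansion N_{L/K}(1 + αλ) = 1 + λ·Tr_{L/K}(α) + λ²·g(λ) for some polynomial g ∈ 𝒪_v[T] depending only on α (not on λ). -/

import Mathlib

section

open Polynomial Pointwise

/-- A domain whose ring of invariants under a finite group is a henselian local ring is local. -/
theorem isLocalRing_of_isInvariant_of_henselian (A B G : Type*) [CommRing A]
    [HenselianLocalRing A] [CommRing B] [IsDomain B] [Algebra A B] [Group G] [Finite G]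
    [MulSemiringAction G B] [SMulCommClass G A B] [Algebra.IsInvariant A B G] :
    IsLocalRing B := by
  classical
  have := Fintype.ofFinite G
  have hint : Algebra.IsIntegral A B := Algebra.IsInvariant.isIntegral A B G
  have hunder : ∀ P : Ideal B, P.IsMaximal → P.under A = IsLocalRing.maximalIdeal A := fun P hP ↦
    IsLocalRing.eq_maximalIdeal (Ideal.isMaximal_comap_of_isIntegral_of_isMaximal P)
  obtain ⟨M, hM⟩ := Ideal.exists_maximal B
  have hMA : ∀ a : A, algebraMap A B a ∈ M ↔ a ∈ IsLocalRing.maximalIdeal A := fun a ↦ by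
    rw [← hunder M hM, Ideal.mem_comap]
  suffices hfix : ∀ g : G, g • M = M by
    refine IsLocalRing.of_unique_max_ideal ⟨M, hM, fun P hP ↦ ?_⟩
    obtain ⟨g, rfl⟩ := Algebra.IsInvariant.exists_smul_of_under_eq A B G M P
      ((hunder M hM).trans (hunder P hP).symm)
    exact hfix g
  -- an element congruent to `1` modulo `M` and to `0` modulo the other conjugates of `M`
  obtain ⟨y, hy1, hy0⟩ : ∃ y : B, y - 1 ∈ M ∧ ∀ g : G, g • M ≠ M → y ∈ g • M := by
    have hsup : M ⊔ ⨅ g ∈ ({g : G | g • M ≠ M} : Finset G), g • M = ⊤ := by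
      refine Ideal.sup_iInf_eq_top fun g hg ↦ ?_
      have : (g • M).IsMaximal := by
        rw [Ideal.pointwise_smul_def]
        exact Ideal.IsMaximal.map_bijective (MulSemiringAction.toRingHom G B g)
          (MulAction.bijective g) hM
      exact hM.coprime_of_ne this (by simpa [eq_comm] using hg)
    obtain ⟨m, hm, n, hn, hmn⟩ := Submodule.mem_sup.mp (hsup ▸ Submodule.mem_top : (1 : B) ∈ _)
    refine ⟨n, ?_, fun g hg ↦ ?_⟩
    · rw [← hmn]; simpa using hm
    · simp only [Submodule.mem_iInf] at hn
      exact hn g (by simpa using hg)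
  have hmem : ∀ (g : G) (b : B), g • b ∈ M ↔ b ∈ g⁻¹ • M := fun g b ↦ by
    rw [Ideal.mem_inv_pointwise_smul_iff]
  obtain ⟨x, hx1, hx0, hxs⟩ : ∃ x : B, x - 1 ∈ M ∧ (∀ g : G, g • M ≠ M → x ∈ g • M) ∧
      ∀ g : G, g • M = M → g • x = x := by
    refine ⟨∏ t : MulAction.stabilizer G M, (t : G) • y, ?_, fun g hg ↦ ?_, fun g hg ↦ ?_⟩
    · rw [← Ideal.Quotient.eq, map_prod, map_one]
      refine Finset.prod_eq_one fun t _ ↦ ?_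
      rw [← map_one (Ideal.Quotient.mk M), Ideal.Quotient.eq, ← smul_one (t : G), ← smul_sub, hmem,
        inv_smul_eq_iff.mpr t.2.symm]
      exact hy1
    · refine Ideal.mem_of_dvd _ (Finset.dvd_prod_of_mem _ (Finset.mem_univ 1)) ?_
      simpa using hy0 g hg
    · rw [Finset.smul_prod']
      exact Fintype.prod_equiv (Equiv.mulLeft (⟨g, hg⟩ : MulAction.stabilizer G M)) _ _
        fun t ↦ by simp [mul_smul]
  obtain ⟨F, hF, -, hFm⟩ := lifts_and_natDegree_eq_and_monic
    ((lifts_iff_coeff_lifts _).mpr fun n ↦ Algebra.IsInvariant.isInvariant (A := A) (G := G) _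
      fun g ↦ prodXSubSMul.coeff G B x g n) (prodXSubSMul.monic G B x)
  have hconj : ∀ q : G ⧸ MulAction.stabilizer G x, q ≠ QuotientGroup.mk 1 →
      MulAction.ofQuotientStabilizer G x q ∈ M := by
    intro q
    induction q using QuotientGroup.induction_on with | H g =>
    intro hq
    rw [MulAction.ofQuotientStabilizer_mk, hmem]
    refine hx0 _ fun h ↦ hq ?_
    rw [QuotientGroup.eq, mul_one]
    exact hxs _ h
  set Q : B[X] := ∏ q ∈ Finset.univ.erase (QuotientGroup.mk 1 : G ⧸ MulAction.stabilizer G x),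
    (X - C (MulAction.ofQuotientStabilizer G x q)) with hQ
  have hFQ : F.map (algebraMap A B) = (X - C x) * Q := by
    rw [hF, prodXSubSMul, ← Finset.mul_prod_erase _ _ (Finset.mem_univ (QuotientGroup.mk 1))]
    simp [hQ]
  have hQ1 : Q.eval 1 - 1 ∈ M := by
    rw [← Ideal.Quotient.eq, hQ, eval_prod, map_prod, map_one]
    refine Finset.prod_eq_one fun q hq ↦ ?_
    rw [← map_one (Ideal.Quotient.mk M), Ideal.Quotient.eq]
    simpa using hconj q (Finset.ne_of_mem_erase hq)
  have h1 : F.eval 1 ∈ IsLocalRing.maximalIdeal A := by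
    rw [← hMA, ← eval_one_map, hFQ, eval_mul]
    refine M.mul_mem_right _ ?_
    simpa using M.neg_mem hx1
  have h2 : IsUnit (F.derivative.eval 1) := by
    rw [← IsLocalRing.notMem_maximalIdeal, ← hMA, ← eval_one_map, ← derivative_map, hFQ]
    intro h
    refine (Ideal.ne_top_iff_one M).mp hM.ne_top ?_
    simp only [derivative_mul, derivative_sub, derivative_X, derivative_C, eval_add, eval_mul,
      eval_sub, eval_X, eval_C, sub_zero, one_mul] at h
    have := M.sub_mem (M.add_mem h (M.mul_mem_right (Q.derivative.eval 1) hx1)) hQ1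
    convert this using 1
    ring
  obtain ⟨a, ha, ha1⟩ := HenselianLocalRing.is_henselian F hFm 1 h1 h2
  have hroot : (prodXSubSMul G B x).eval (algebraMap A B a) = 0 := by
    rw [← hF, eval_map_apply, ha.eq_zero, map_zero]
  rw [prodXSubSMul, eval_prod, Finset.prod_eq_zero_iff] at hroot
  obtain ⟨q, -, hq⟩ := hroot
  induction q using QuotientGroup.induction_on with | H s =>
  have hxa : x = algebraMap A B a := by
    rw [eval_sub, eval_X, eval_C, sub_eq_zero, MulAction.ofQuotientStabilizer_mk] at hq
    rw [← inv_smul_smul s x, ← hq, smul_algebraMap]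
  intro g
  by_contra hg
  have hxM := hx0 g hg
  rw [hxa, Ideal.mem_pointwise_smul_iff_inv_smul_mem, smul_algebraMap, ← hxa] at hxM
  refine (Ideal.ne_top_iff_one M).mp hM.ne_top ?_
  simpa using M.sub_mem hxM hx1

theorem isLocalRing_integralClosure_of_isGalois (A K N : Type*) [CommRing A]
    [HenselianLocalRing A] [IsIntegrallyClosed A] [Field K] [Algebra A K] [IsFractionRing A K]
    [Field N] [Algebra K N] [Algebra A N] [IsScalarTower A K N] [FiniteDimensional K N]
    [IsGalois K N] : IsLocalRing (integralClosure A N) := by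
  have : Algebra.IsInvariant A (integralClosure A N) Gal(N/K) := by
    refine ⟨fun x hx ↦ ?_⟩
    obtain ⟨k, hk⟩ := (IsGalois.mem_bot_iff_fixed (F := K) (x : N)).mpr fun g ↦
      congrArg Subtype.val (hx g)
    obtain ⟨a, ha⟩ := IsIntegrallyClosed.isIntegral_iff.mp
      ((isIntegral_algebraMap_iff (algebraMap K N).injective).mp
        ((show algebraMap K N k = x from hk) ▸ x.2 : IsIntegral A (algebraMap K N k)))
    refine ⟨a, Subtype.ext ?_⟩
    rw [← hk, ← ha]
    exact IsScalarTower.algebraMap_apply A K N a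
  exact isLocalRing_of_isInvariant_of_henselian A (integralClosure A N) Gal(N/K)

/-- The integral closure of a normal henselian local ring in a finite separable extension of its
fraction field is local. -/
theorem isLocalRing_integralClosure_of_isSeparable (A K L : Type*) [CommRing A]
    [HenselianLocalRing A] [IsIntegrallyClosed A] [Field K] [Algebra A K] [IsFractionRing A K]
    [Field L] [Algebra K L] [Algebra A L] [IsScalarTower A K L] [FiniteDimensional K L]
    [Algebra.IsSeparable K L] : IsLocalRing (integralClosure A L) := by
  let N := IntermediateField.normalClosure K L (AlgebraicClosure L)
  have : IsScalarTower A L N := .of_algebraMap_eq fun a ↦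
    Subtype.ext (IsScalarTower.algebraMap_apply A L (AlgebraicClosure L) a)
  have : ∀ f : L →ₐ[K] AlgebraicClosure L, Algebra.IsSeparable K f.fieldRange := fun f ↦
    .of_algHom K L (AlgEquiv.ofInjectiveField f).symm.toAlgHom
  have : Algebra.IsSeparable K N := IntermediateField.isSeparable_iSup K (AlgebraicClosure L)
  have : IsGalois K N := ⟨⟩
  have := isLocalRing_integralClosure_of_isGalois A K N
  let f : integralClosure A L →ₐ[A] integralClosure A N :=
    (IsScalarTower.toAlgHom A L N).mapIntegralClosure
  have hf : Function.Injective f := fun x y h ↦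
    Subtype.ext ((algebraMap L N).injective (congrArg Subtype.val h))
  have : IsLocalHom f.toRingHom := by
    refine RingHom.IsIntegral.isLocalHom (RingHom.IsIntegral.tower_top (algebraMap A _) _ ?_) hf
    exact f.comp_algebraMap ▸ fun x ↦ integralClosure.isIntegral x
  exact RingHom.domain_isLocalRing f.toRingHom

/-- Let `R` be integrally closed in `L` and dominated by the valuation ring of `w`. An element of
this valuation ring which is a root of a polynomial over `R` with a coefficient of valuation `1`
is integral over `R`. -/
theorem isIntegral_of_aeval_eq_zero_of_valuation_coeff_eq_one {R L Γ : Type*}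
    [CommRing R] [Field L] [Algebra R L] [IsIntegrallyClosedIn R L]
    [LinearOrderedCommGroupWithZero Γ] (w : Valuation L Γ)
    (hw : ∀ r : R, w (algebraMap R L r) ≤ 1)
    (hunit : ∀ r : R, w (algebraMap R L r) = 1 → IsUnit r) {x : L} (hx : w x ≤ 1)
    (n : ℕ) (p : R[X]) (hn : p.natDegree ≤ n) (hp : aeval x p = 0)
    (hi : ∃ i, w (algebraMap R L (p.coeff i)) = 1) : IsIntegral R x := by
  induction n generalizing p with
  | zero =>
    obtain ⟨i, hi⟩ := hi
    rw [eq_C_of_natDegree_le_zero hn] at hp hi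
    rw [aeval_C] at hp
    rw [coeff_C] at hi
    split_ifs at hi <;> simp_all
  | succ n ih =>
    have hint : IsIntegral R (algebraMap R L (p.coeff (n + 1)) * x) := by
      obtain h | h := hn.lt_or_eq
      · rw [coeff_eq_zero_of_natDegree_lt h, map_zero, zero_mul]
        exact isIntegral_zero
      · rw [← h, ← Algebra.smul_def]
        exact isIntegral_leadingCoeff_smul p x hp
    obtain hlt | heq := (hw (p.coeff (n + 1))).lt_or_eq
    · obtain ⟨c, hc⟩ := IsIntegrallyClosedIn.algebraMap_eq_of_integral hint
      have hcw : w (algebraMap R L c) < 1 := by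
        rw [hc, map_mul]
        exact mul_lt_one_of_lt_of_le hlt hx
      have hsplit : p = p.erase (n + 1) + monomial (n + 1) (p.coeff (n + 1)) := by
        rw [add_comm, monomial_add_erase]
      refine ih (p.erase (n + 1) + monomial n c) ?_ ?_ ?_
      · refine natDegree_add_le_of_degree_le ?_ (natDegree_monomial_le _)
        rw [natDegree_le_iff_coeff_eq_zero]
        intro k hk
        rw [coeff_erase]
        split_ifs with h
        · rfl
        · exact coeff_eq_zero_of_natDegree_lt (by lia)
      · rw [hsplit, map_add] at hp
        rw [map_add, ← hp, aeval_monomial, aeval_monomial, hc]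
        ring
      · obtain ⟨i, hi⟩ := hi
        have hin : i ≠ n + 1 := by rintro rfl; exact hlt.ne hi
        refine ⟨i, ?_⟩
        rw [coeff_add, coeff_erase, if_neg hin, coeff_monomial]
        split_ifs with h
        · rw [map_add, Valuation.map_add_eq_of_lt_left _ (hcw.trans_eq hi.symm), hi]
        · rw [add_zero, hi]
    · obtain ⟨u, hu⟩ := hunit _ heq
      rw [← hu] at hint
      have := hint.smul ((u⁻¹ : Rˣ) : R)
      rwa [Algebra.smul_def, ← mul_assoc, ← map_mul, Units.inv_mul, map_one, one_mul] at this

/-- Over a henselian valuation ring, every element of the valuation ring of an extension of the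
valuation to a finite separable extension is integral. -/
theorem isIntegral_of_valuation_le_one {K L Γ : Type*} [Field K] [Field L] [Algebra K L]
    [FiniteDimensional K L] [Algebra.IsSeparable K L] [LinearOrderedCommGroupWithZero Γ]
    (v : Valuation K Γ) (w : Valuation L Γ) [HenselianLocalRing v.valuationSubring]
    (hext : ∀ x : K, w (algebraMap K L x) = v x) {x : L} (hx : w x ≤ 1) :
    IsIntegral v.valuationSubring x := by
  let A := v.valuationSubring
  let B := integralClosure A L
  have hloc : IsLocalRing B := isLocalRing_integralClosure_of_isSeparable A K L
  have hwA : ∀ a : A, w (algebraMap A L a) = v a := fun a ↦ hext a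
  have hwB : ∀ b : B, w (algebraMap B L b) ≤ 1 := fun b ↦ by
    let φ : A →+* w.integer := (algebraMap A L).codRestrict w.integer fun a ↦ (hwA a).trans_le a.2
    exact (Valuation.integer.integers w).mem_of_integral
      (b.2.map_of_comp_eq φ (RingHom.id L) rfl)
  -- the ideal of `B` cut out by `w < 1` lies over the maximal ideal of `A`
  let P : Ideal B :=
    { carrier := {b | w (algebraMap B L b) < 1}
      add_mem' := fun {a b} ha hb ↦ by
        simpa using w.map_add_lt ha hb
      zero_mem' := by simp
      smul_mem' := fun c b hb ↦ by
        show w (algebraMap B L (c * b)) < 1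
        rw [map_mul, map_mul, mul_comm]
        exact mul_lt_one_of_lt_of_le hb (hwB c) }
  have hP : P.IsPrime := by
    refine ⟨(Ideal.ne_top_iff_one P).mpr fun h ↦ ?_, fun {a b} hab ↦ ?_⟩
    · exact absurd (show w (algebraMap B L 1) < 1 from h) (by simp)
    · by_contra! h
      have ha : w (algebraMap B L a) = 1 := (hwB a).eq_of_not_lt h.1
      have hb : w (algebraMap B L b) = 1 := (hwB b).eq_of_not_lt h.2
      have hab : w (algebraMap B L (a * b)) < 1 := hab
      rw [map_mul, map_mul, ha, hb, one_mul] at hab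
      exact hab.false
  have hPA : P.under A = IsLocalRing.maximalIdeal A := by
    ext a
    rw [Ideal.mem_comap, Valuation.mem_maximalIdeal_iff, ← hwA]
    rfl
  have hPmax : P = IsLocalRing.maximalIdeal B := by
    refine IsLocalRing.eq_maximalIdeal ?_
    refine Ideal.isMaximal_of_isIntegral_of_isMaximal_comap (R := A) P ?_
    exact (show Ideal.comap (algebraMap A B) P = _ from hPA) ▸ IsLocalRing.maximalIdeal.isMaximal A
  have hunit : ∀ b : B, w (algebraMap B L b) = 1 → IsUnit b := fun b hb ↦ by
    rw [← IsLocalRing.notMem_maximalIdeal, ← hPmax]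
    exact hb.not_lt
  -- a primitive polynomial over `A` vanishing at `x`
  obtain ⟨p, hpx, i, hpi⟩ : ∃ p : A[X], aeval x p = 0 ∧ ∃ i, v (p.coeff i) = 1 := by
    set q := minpoly K x
    have hq : q ≠ 0 := minpoly.ne_zero (Algebra.IsIntegral.isIntegral x)
    obtain ⟨i, hi, hmax⟩ := q.support.exists_max_image (fun i ↦ v (q.coeff i))
      (nonempty_support_iff.mpr hq)
    have hi0 : q.coeff i ≠ 0 := mem_support_iff.mp hi
    have hvi : 0 < v (q.coeff i) := zero_lt_iff.mpr ((v.ne_zero_iff).mpr hi0)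
    have hle : ∀ j, v (q.coeff j) ≤ v (q.coeff i) := fun j ↦ by
      by_cases hj : q.coeff j = 0
      · simp [hj]
      · exact hmax j (mem_support_iff.mpr hj)
    obtain ⟨p, hp⟩ := (lifts_iff_coeff_lifts (f := algebraMap A K) (C (q.coeff i)⁻¹ * q)).mpr
      fun j ↦ ⟨⟨(q.coeff i)⁻¹ * q.coeff j, by
        rw [Valuation.mem_valuationSubring_iff, map_mul, map_inv₀]
        exact inv_mul_le_one_of_le₀ (hle j) zero_le⟩, by rw [coeff_C_mul]; rfl⟩
    rw [coe_mapRingHom] at hp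
    refine ⟨p, ?_, i, ?_⟩
    · rw [← aeval_map_algebraMap K, hp, map_mul, minpoly.aeval, mul_zero]
    · have : (p.coeff i : K) = (q.coeff i)⁻¹ * q.coeff i := by
        rw [← coeff_C_mul, ← hp, coeff_map]; rfl
      rw [this, inv_mul_cancel₀ hi0, map_one]
  have := isIntegral_of_aeval_eq_zero_of_valuation_coeff_eq_one w hwB hunit hx _
    (p.map (algebraMap A B)) le_rfl (by rwa [aeval_map_algebraMap])
    ⟨i, by rw [coeff_map, ← IsScalarTower.algebraMap_apply, hwA, hpi]⟩
  exact isIntegral_trans x this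

/-- A monic polynomial with integral roots has integral coefficients. -/
theorem isIntegral_coeff_of_roots {A K E : Type*} [CommRing A] [Field K] [Field E] [Algebra A K]
    [Algebra K E] [Algebra A E] [IsScalarTower A K E] {p : K[X]} (hp : p.Monic)
    (hs : (p.map (algebraMap K E)).Splits) (hr : ∀ r ∈ p.aroots E, IsIntegral A r) (i : ℕ) :
    IsIntegral A (p.coeff i) := by
  rw [← isIntegral_algebraMap_iff (algebraMap K E).injective, ← coeff_map]
  let _ : Algebra A[X] E[X] := Polynomial.algebra A E
  refine IsIntegral.coeff ?_ i
  rw [hs.eq_prod_roots_of_monic (hp.map _)]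
  refine IsIntegral.multiset_prod fun q hq ↦ ?_
  obtain ⟨r, hrm, rfl⟩ := Multiset.mem_map.mp hq
  refine IsIntegral.sub ?_ ?_
  · simpa using isIntegral_algebraMap (R := A[X]) (A := E[X]) (x := X)
  · exact (hr r hrm).map_of_comp_eq C C (by ext; simp)

theorem isIntegral_coeff_charpoly_leftMulMatrix {A K L ι : Type*} [CommRing A] [Field K] [Field L]
    [Algebra A K] [Algebra K L] [Algebra A L] [IsScalarTower A K L] [Fintype ι] [DecidableEq ι]
    (b : Module.Basis ι K L) {x : L} (hx : IsIntegral A x) (i : ℕ) :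
    IsIntegral A ((Algebra.leftMulMatrix b x).charpoly.coeff i) := by
  let E := AlgebraicClosure K
  have : Nonempty ι := b.index_nonempty
  refine isIntegral_coeff_of_roots (E := E) (Matrix.charpoly_monic _)
    (IsAlgClosed.splits _) (fun r hr ↦ ?_) i
  obtain ⟨p, hp, hpx⟩ := hx
  refine ⟨p, hp, ?_⟩
  have hr := isRoot_of_mem_roots hr
  rw [← Matrix.charpoly_map, ← Matrix.mem_spectrum_iff_isRoot_charpoly] at hr
  have h0 : aeval ((algebraMap K E).mapMatrix (Algebra.leftMulMatrix b x))
      (p.map (algebraMap A E)) = 0 := by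
    have h1 : aeval (Algebra.leftMulMatrix b x) (p.map (algebraMap A K)) = 0 := by
      rw [aeval_algHom_apply, aeval_map_algebraMap, aeval_def, hpx, map_zero]
    rw [IsScalarTower.algebraMap_eq A K E, ← map_map, aeval_map_algebraMap]
    have := aeval_algHom_apply (Algebra.ofId K E).mapMatrix (Algebra.leftMulMatrix b x)
      (p.map (algebraMap A K))
    rw [h1, map_zero] at this
    exact this
  have := spectrum.subset_polynomial_aeval _ (p.map (algebraMap A E)) ⟨r, hr, rfl⟩
  rw [RingHom.mapMatrix_apply] at h0
  rw [h0, spectrum.zero_eq, Set.mem_singleton_iff] at this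
  exact (eval_map _ _).symm.trans this

theorem exists_norm_one_add_mul_eq {K L : Type*} [Field K] [Field L] [Algebra K L]
    [FiniteDimensional K L] {A : Type*} [CommRing A] [Algebra A K] [Algebra A L]
    [IsScalarTower A K L] {x : L} (hx : IsIntegral A x) :
    ∃ g : K[X], (∀ i, IsIntegral A (g.coeff i)) ∧ ∀ c : K,
      Algebra.norm K (1 + x * algebraMap K L c) =
        1 + c * Algebra.trace K L x + c ^ 2 * g.eval c := by
  classical
  let b := Module.finBasis K L
  set P := (Algebra.leftMulMatrix b (-x)).charpolyRev with hP
  refine ⟨P.divX.divX, fun i ↦ ?_, fun c ↦ ?_⟩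
  · rw [coeff_divX, coeff_divX, hP, ← Matrix.reverse_charpoly, coeff_reverse]
    exact isIntegral_coeff_charpoly_leftMulMatrix b hx.neg _
  · have h1 : P.coeff 0 = 1 := by rw [coeff_zero_eq_eval_zero, hP, Matrix.eval_charpolyRev]
    have h2 : P.coeff 1 = Algebra.trace K L x := by
      rw [hP, Matrix.coeff_charpolyRev_eq_neg_trace, ← Algebra.trace_eq_matrix_trace, map_neg,
        neg_neg]
    have h3 : Algebra.norm K (1 + x * algebraMap K L c) = P.eval c := by
      rw [Algebra.norm_eq_matrix_det b, hP, Matrix.charpolyRev, ← coe_evalRingHom, RingHom.map_det]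
      congr 1
      ext i j
      simp [Matrix.one_apply, apply_ite, mul_comm x, ← Algebra.smul_def]
      ring
    have h4 : P.eval c = P.divX.eval c * c + P.coeff 0 := by
      conv_lhs => rw [← divX_mul_X_add P]
      simp
    have h5 : P.divX.eval c = P.divX.divX.eval c * c + P.coeff 1 := by
      conv_lhs => rw [← divX_mul_X_add P.divX]
      simp [coeff_divX]
    rw [h3, h4, h5, h1, h2]
    ring

end

/-- Expansion of the norm: for a finite separable extension (L,w)/(K,v) of henselian
valued fields and α ∈ 𝒪_w with Tr_{L/K}(α) ≠ 0, there is a polynomial g ∈ 𝒪_v[T]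
(depending only on α) such that N_{L/K}(1 + αλ) = 1 + λ·Tr_{L/K}(α) + λ²·g(λ) for all
λ ∈ K. -/
theorem stmt_10 (K : Type*) [Field K] (L : Type*) [Field L] [Algebra K L]
    [FiniteDimensional K L] [Algebra.IsSeparable K L]
    (Γ : Type*) [LinearOrderedCommGroupWithZero Γ]
    (v : Valuation K Γ) (w : Valuation L Γ)
    [HenselianLocalRing ↥v.valuationSubring] [HenselianLocalRing ↥w.valuationSubring]
    (hext : ∀ x : K, w (algebraMap K L x) = v x)
    (α : L) (hα : w α ≤ 1) (hTr : Algebra.trace K L α ≠ 0) :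
    ∃ g : Polynomial K, (∀ i, g.coeff i ∈ v.valuationSubring) ∧
      ∀ lam : K, Algebra.norm K (1 + α * algebraMap K L lam)
        = 1 + lam * Algebra.trace K L α + lam ^ 2 * g.eval lam := by
  obtain ⟨g, hg, hnorm⟩ := exists_norm_one_add_mul_eq (K := K)
    (isIntegral_of_valuation_le_one v w hext hα)
  refine ⟨g, fun i ↦ ?_, hnorm⟩
  obtain ⟨a, ha⟩ := IsIntegrallyClosed.isIntegral_iff.mp (hg i)
  exact ha ▸ a.2
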